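/- arXiv:2402.15416 — 8 statements merged into one kernel-verified Lean document; each statement's English description precedes it below -/
import Mathlib

section
/- For the complete graph K_n on n ≥ 2 vertices, LE_CN(K_n) = 2(n-1)(n-2) and LE⁺_CN(K_n) = 2(n-1)(n-2). -/
set_option linter.unusedSectionVars false

open Matrix BigOperators Finset

namespace CNE

variable {V : Type*} [Fintype V]

/-- The common neighborhood matrix `CN(G)`. -/
noncomputable def cn [DecidableEq V] (G : SimpleGraph V) : Matrix V V ℝ :=
  Matrix.of fun i j => if i = j then 0 else (Nat.card (G.commonNeighbors i j) : ℝ)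

/-- The common neighborhood row sum (diagonal) matrix `CNRS(G)`. -/
noncomputable def cnrs [DecidableEq V] (G : SimpleGraph V) : Matrix V V ℝ :=
  Matrix.diagonal fun i => ∑ j, cn G i j

/-- The common neighborhood Laplacian matrix `CNL(G) = CNRS(G) - CN(G)`. -/
noncomputable def cnl [DecidableEq V] (G : SimpleGraph V) : Matrix V V ℝ :=
  cnrs G - cn G

/-- The common neighborhood signless Laplacian matrix `CNSL(G) = CNRS(G) + CN(G)`. -/
noncomputable def cnsl [DecidableEq V] (G : SimpleGraph V) : Matrix V V ℝ :=
  cnrs G + cn G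

lemma cn_isHermitian [DecidableEq V] (G : SimpleGraph V) : (cn G).IsHermitian := by
  ext i j
  simp only [Matrix.conjTranspose_apply, cn, Matrix.of_apply, star_trivial]
  rw [SimpleGraph.commonNeighbors_symm]
  by_cases h : i = j
  · simp [h]
  · rw [if_neg h, if_neg fun hji => h hji.symm]

lemma cnrs_isHermitian [DecidableEq V] (G : SimpleGraph V) : (cnrs G).IsHermitian :=
  Matrix.isHermitian_diagonal _

lemma cnl_isHermitian [DecidableEq V] (G : SimpleGraph V) : (cnl G).IsHermitian :=
  (cnrs_isHermitian G).sub (cn_isHermitian G)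

lemma cnsl_isHermitian [DecidableEq V] (G : SimpleGraph V) : (cnsl G).IsHermitian :=
  (cnrs_isHermitian G).add (cn_isHermitian G)

/-- The common neighborhood energy `E_CN(G)`: the sum of the absolute values of the
eigenvalues (with multiplicity) of `CN(G)`. -/
noncomputable def Ecn [DecidableEq V] (G : SimpleGraph V) : ℝ :=
  ∑ i, |(cn_isHermitian G).eigenvalues i|

/-- The common neighborhood Laplacian energy `LE_CN(G)`. -/
noncomputable def LEcn [DecidableEq V] (G : SimpleGraph V) : ℝ :=
  ∑ i, |(cnl_isHermitian G).eigenvalues i - (cnrs G).trace / (Fintype.card V : ℝ)|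

/-- The common neighborhood signless Laplacian energy `LE⁺_CN(G)`. -/
noncomputable def LEpcn [DecidableEq V] (G : SimpleGraph V) : ℝ :=
  ∑ i, |(cnsl_isHermitian G).eigenvalues i - (cnrs G).trace / (Fintype.card V : ℝ)|

open Classical in
/-- The (real) adjacency matrix of a graph, defined classically. -/
noncomputable def adjMat (G : SimpleGraph V) : Matrix V V ℝ :=
  Matrix.of fun i j => if G.Adj i j then 1 else 0

lemma adjMat_isHermitian (G : SimpleGraph V) : (adjMat G).IsHermitian := by
  ext i j
  simp only [Matrix.conjTranspose_apply, adjMat, Matrix.of_apply, star_trivial]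
  by_cases h : G.Adj i j
  · simp [h, h.symm]
  · have h' : ¬ G.Adj j i := fun hji => h hji.symm
    simp [h, h']

/-- The diagonal degree matrix of a graph. -/
noncomputable def degMat [DecidableEq V] (G : SimpleGraph V) : Matrix V V ℝ :=
  Matrix.diagonal fun v => (Nat.card (G.neighborSet v) : ℝ)

/-- The Laplacian matrix `L(G) = D(G) - A(G)`. -/
noncomputable def lap [DecidableEq V] (G : SimpleGraph V) : Matrix V V ℝ :=
  degMat G - adjMat G

/-- The signless Laplacian matrix `Q(G) = D(G) + A(G)`. -/
noncomputable def slap [DecidableEq V] (G : SimpleGraph V) : Matrix V V ℝ :=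
  degMat G + adjMat G

lemma degMat_isHermitian [DecidableEq V] (G : SimpleGraph V) : (degMat G).IsHermitian :=
  Matrix.isHermitian_diagonal _

lemma lap_isHermitian [DecidableEq V] (G : SimpleGraph V) : (lap G).IsHermitian :=
  (degMat_isHermitian G).sub (adjMat_isHermitian G)

lemma slap_isHermitian [DecidableEq V] (G : SimpleGraph V) : (slap G).IsHermitian :=
  (degMat_isHermitian G).add (adjMat_isHermitian G)

/-- The energy `E(G)` of a graph: the sum of the absolute values of the eigenvalues
(with multiplicity) of the adjacency matrix. -/
noncomputable def energy [DecidableEq V] (G : SimpleGraph V) : ℝ :=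
  ∑ i, |(adjMat_isHermitian G).eigenvalues i|

/-- The Laplacian energy `LE(G)`. -/
noncomputable def LE [DecidableEq V] (G : SimpleGraph V) : ℝ :=
  ∑ i, |(lap_isHermitian G).eigenvalues i - (degMat G).trace / (Fintype.card V : ℝ)|

/-- The signless Laplacian energy `LE⁺(G)`. -/
noncomputable def LEp [DecidableEq V] (G : SimpleGraph V) : ℝ :=
  ∑ i, |(slap_isHermitian G).eigenvalues i - (degMat G).trace / (Fintype.card V : ℝ)|

/-- The derived graph `G†`: two vertices are adjacent iff their distance in `G` is two. -/
def derivedGraph (G : SimpleGraph V) : SimpleGraph V where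
  Adj u v := G.dist u v = 2
  symm := by
    constructor
    intro u v h
    rwa [SimpleGraph.dist_comm]
  loopless := by
    constructor
    intro v h
    simp [SimpleGraph.dist_self] at h

lemma abs_sum_aux (n : ℕ) (hn : 2 ≤ n) (M : Matrix (Fin n) (Fin n) ℝ) (hM : M.IsHermitian)
    (c d : ℝ) (h : ∀ i j, M i j = if i = j then d else c) :
    ∑ i, |hM.eigenvalues i - d| = 2 * ((n : ℝ) - 1) * |c| := by
  have hn0 : (2 : ℝ) ≤ n := by exact_mod_cast hn
  have key : ∀ i, hM.eigenvalues i - d = -c ∨ hM.eigenvalues i - d = (n - 1) * c := by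
    intro i
    have hv := hM.mulVec_eigenvectorBasis i
    have hne : hM.eigenvectorBasis i ≠ 0 := hM.eigenvectorBasis.orthonormal.ne_zero i
    set l := hM.eigenvalues i
    set v := hM.eigenvectorBasis i
    have h1 : ∀ k, (d - c) * v k + c * ∑ j, v j = l * v k := by
      intro k
      have := congrFun hv k
      simp only [Matrix.mulVec, dotProduct, h, Pi.smul_apply, smul_eq_mul] at this
      rw [← this, Finset.mul_sum]
      have h2 : ∀ j, (if k = j then d else c) * v j = (if k = j then (d - c) * v j else 0) + c * v j := by
        intro j; split_ifs <;> ring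
      simp only [h2, Finset.sum_add_distrib, Finset.sum_ite_eq, Finset.mem_univ, if_true]
    have h3 : (d - c + n * c - l) * ∑ j, v j = 0 := by
      have := Finset.sum_congr rfl (fun k (_ : k ∈ Finset.univ) => h1 k)
      rw [Finset.sum_add_distrib, ← Finset.mul_sum, ← Finset.mul_sum] at this
      simp only [Finset.sum_const, Finset.card_univ, Fintype.card_fin, nsmul_eq_mul] at this
      rw [← Finset.mul_sum] at this
      linarith
    rcases mul_eq_zero.1 h3 with h4 | h4
    · right; linarith
    · left
      by_contra hl
      apply hne
      ext k
      have h5 := h1 k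
      rw [h4] at h5
      have h6 : (l - d + c) * v k = 0 := by linarith
      rcases mul_eq_zero.1 h6 with h7 | h7
      · exact absurd (by linarith) hl
      · simpa using h7
  have tr : ∑ i, (hM.eigenvalues i - d) = 0 := by
    have h1 := hM.trace_eq_sum_eigenvalues
    simp only [Matrix.trace, Matrix.diag, h] at h1
    simp at h1
    simp [Finset.sum_sub_distrib, ← h1]
  obtain ⟨b, hb⟩ : ∃ b : ℝ, ∀ i, |hM.eigenvalues i - d|
      = (2 * ((n : ℝ) - 1) * |c|) / n + b * (hM.eigenvalues i - d) := by
    rcases le_total 0 c with hc | hc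
    · refine ⟨(n - 2) / n, fun i => ?_⟩
      rcases key i with hk | hk <;> rw [hk]
      · rw [abs_neg, abs_of_nonneg hc]; field_simp; ring
      · rw [abs_mul, abs_of_nonneg hc, abs_of_nonneg (by linarith)]; field_simp; ring
    · refine ⟨-((n - 2) / n), fun i => ?_⟩
      rcases key i with hk | hk <;> rw [hk]
      · rw [abs_neg, abs_of_nonpos hc]; field_simp; ring
      · rw [abs_mul, abs_of_nonpos hc, abs_of_nonneg (by linarith)]; field_simp; ring
  simp only [hb, Finset.sum_add_distrib, ← Finset.mul_sum, tr]
  simp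
  field_simp

lemma cn_top (n : ℕ) (hn : 2 ≤ n) (i j : Fin n) :
    cn (⊤ : SimpleGraph (Fin n)) i j = if i = j then 0 else (n : ℝ) - 2 := by
  simp only [cn, Matrix.of_apply]
  split_ifs with hij
  · rfl
  · have := SimpleGraph.card_commonNeighbors_top (V := Fin n) hij
    rw [Nat.card_eq_fintype_card, this, Fintype.card_fin, Nat.cast_sub hn]; norm_num

lemma cn_top_sum (n : ℕ) (hn : 2 ≤ n) (i : Fin n) :
    ∑ j, cn (⊤ : SimpleGraph (Fin n)) i j = ((n : ℝ) - 1) * (n - 2) := by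
  have h2 : ∀ j, cn (⊤ : SimpleGraph (Fin n)) i j
      = ((n : ℝ) - 2) - (if i = j then (n : ℝ) - 2 else 0) := by
    intro j; rw [cn_top n hn]; split_ifs <;> ring
  simp only [h2, Finset.sum_sub_distrib, Finset.sum_ite_eq, Finset.mem_univ, if_true]
  simp
  ring

lemma cnrs_top_trace (n : ℕ) (hn : 2 ≤ n) :
    (cnrs (⊤ : SimpleGraph (Fin n))).trace / (Fintype.card (Fin n) : ℝ)
      = ((n : ℝ) - 1) * (n - 2) := by
  have hn0 : (n : ℝ) ≠ 0 := by positivity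
  simp only [cnrs, Matrix.trace_diagonal, cn_top_sum n hn]
  simp
  field_simp

theorem statement3 (n : ℕ) (hn : 2 ≤ n) :
    LEcn (⊤ : SimpleGraph (Fin n)) = 2 * ((n : ℝ) - 1) * ((n : ℝ) - 2) ∧
    LEpcn (⊤ : SimpleGraph (Fin n)) = 2 * ((n : ℝ) - 1) * ((n : ℝ) - 2) := by
  have hn0 : (2 : ℝ) ≤ n := by exact_mod_cast hn
  constructor
  · rw [LEcn, cnrs_top_trace n hn, abs_sum_aux n hn _ _ (-((n : ℝ) - 2)), abs_neg,
      abs_of_nonneg (by linarith)]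
    intro i j
    rw [cnl, Matrix.sub_apply, cn_top n hn, cnrs, Matrix.diagonal_apply, cn_top_sum n hn]
    split_ifs <;> ring
  · rw [LEpcn, cnrs_top_trace n hn, abs_sum_aux n hn _ _ ((n : ℝ) - 2),
      abs_of_nonneg (by linarith)]
    intro i j
    rw [cnsl, Matrix.add_apply, cn_top n hn, cnrs, Matrix.diagonal_apply, cn_top_sum n hn]
    split_ifs <;> ring

end CNE
end

section
/- For the complete bipartite graph K_{m,n} on m + n vertices (m, n ≥ 1), the CN-Laplacian energy satisfies LE_CN(K_{m,n}) = 4mn(m+n-2)/(m+n). -/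
set_option linter.unusedSectionVars false

open Matrix BigOperators Finset

namespace CNE

variable {V : Type*} [Fintype V]

lemma cn_kmn (m n : ℕ) : cn (completeBipartiteGraph (Fin m) (Fin n)) =
    Matrix.fromBlocks ((n:ℝ) • (Matrix.of (fun _ _ => 1) - 1)) 0 0
      ((m:ℝ) • (Matrix.of (fun _ _ => 1) - 1)) := by
  have hL : ∀ i j : Fin m, Nat.card ((completeBipartiteGraph (Fin m) (Fin n)).commonNeighbors
      (Sum.inl i) (Sum.inl j)) = n := by
    intro i j
    have : (completeBipartiteGraph (Fin m) (Fin n)).commonNeighbors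
      (Sum.inl i) (Sum.inl j) = Set.range Sum.inr := by
      ext x; cases x <;> simp [SimpleGraph.mem_commonNeighbors]
    rw [this, Nat.card_range_of_injective Sum.inr_injective]; simp
  have hR : ∀ i j : Fin n, Nat.card ((completeBipartiteGraph (Fin m) (Fin n)).commonNeighbors
      (Sum.inr i) (Sum.inr j)) = m := by
    intro i j
    have : (completeBipartiteGraph (Fin m) (Fin n)).commonNeighbors
      (Sum.inr i) (Sum.inr j) = Set.range Sum.inl := by
      ext x; cases x <;> simp [SimpleGraph.mem_commonNeighbors]
    rw [this, Nat.card_range_of_injective Sum.inl_injective]; simp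
  have hLR : ∀ (i : Fin m) (j : Fin n),
      (completeBipartiteGraph (Fin m) (Fin n)).commonNeighbors
      (Sum.inl i) (Sum.inr j) = ∅ := by
    intro i j
    ext x; cases x <;> simp [SimpleGraph.mem_commonNeighbors]
  have hRL : ∀ (i : Fin m) (j : Fin n),
      (completeBipartiteGraph (Fin m) (Fin n)).commonNeighbors
      (Sum.inr j) (Sum.inl i) = ∅ := by
    intro i j
    ext x; cases x <;> simp [SimpleGraph.mem_commonNeighbors]
  ext i j
  rcases i with i | i <;> rcases j with j | j
  · by_cases h : i = j <;> simp only [cn, Matrix.of_apply, hL] <;> simp [h, Matrix.one_apply]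
  · simp only [cn, Matrix.of_apply, hLR]; simp
  · simp only [cn, Matrix.of_apply, hRL]; simp
  · by_cases h : i = j <;> simp only [cn, Matrix.of_apply, hR] <;> simp [h, Matrix.one_apply]

lemma cnrs_kmn (m n : ℕ) : cnrs (completeBipartiteGraph (Fin m) (Fin n)) =
    Matrix.fromBlocks (((n:ℝ) * (m - 1)) • 1) 0 0 (((m:ℝ) * (n - 1)) • 1) := by
  ext i j
  rw [cnrs, cn_kmn]
  rcases i with i | i <;> rcases j with j | j <;>
    simp [Matrix.diagonal_apply, Matrix.one_apply, ← Finset.mul_sum, Finset.sum_sub_distrib]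

lemma cnl_sq (m n : ℕ) : cnl (completeBipartiteGraph (Fin m) (Fin n)) *
    cnl (completeBipartiteGraph (Fin m) (Fin n)) =
    ((m:ℝ) * n) • cnl (completeBipartiteGraph (Fin m) (Fin n)) := by
  have key : ∀ k : ℕ, (Matrix.of (fun _ _ => 1) : Matrix (Fin k) (Fin k) ℝ) *
      Matrix.of (fun _ _ => 1) = (k:ℝ) • Matrix.of (fun _ _ => 1) := by
    intro k; ext i j; simp [Matrix.mul_apply]
  have h : cnl (completeBipartiteGraph (Fin m) (Fin n)) =
    Matrix.fromBlocks ((n:ℝ) • ((m:ℝ) • 1 - Matrix.of (fun _ _ => 1))) 0 0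
      ((m:ℝ) • ((n:ℝ) • 1 - Matrix.of (fun _ _ => 1))) := by
    rw [cnl, cnrs_kmn, cn_kmn, sub_eq_add_neg, Matrix.fromBlocks_neg, Matrix.fromBlocks_add]
    congr 1
    · module
    · simp
    · simp
    · module
  rw [h, Matrix.fromBlocks_multiply, Matrix.fromBlocks_smul]
  congr 1
  · simp [sub_mul, mul_sub, key]; module
  · simp
  · simp
  · simp [sub_mul, mul_sub, key]; module

lemma eig_quad {V : Type*} [Fintype V] [DecidableEq V] {A : Matrix V V ℝ} (hA : A.IsHermitian)
    (c : ℝ) (h : A * A = c • A) (i : V) :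
    hA.eigenvalues i = 0 ∨ hA.eigenvalues i = c := by
  have h1 := hA.mulVec_eigenvectorBasis i
  set v : V → ℝ := ⇑(hA.eigenvectorBasis i) with hv
  have hv0 : v ≠ 0 := by
    intro h0
    apply hA.eigenvectorBasis.orthonormal.ne_zero i
    ext j
    exact congrFun h0 j
  have h2 : (A * A) *ᵥ v = (c • A) *ᵥ v := by rw [h]
  rw [← Matrix.mulVec_mulVec, Matrix.smul_mulVec, h1, Matrix.mulVec_smul, h1, smul_smul,
    smul_smul] at h2
  have h3 := smul_left_injective ℝ hv0 h2
  have h4 : hA.eigenvalues i * (hA.eigenvalues i - c) = 0 := by linarith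
  rcases mul_eq_zero.mp h4 with h | h
  · exact Or.inl h
  · right; linarith

theorem statement4 (m n : ℕ) (hm : 1 ≤ m) (hn : 1 ≤ n) :
    LEcn (completeBipartiteGraph (Fin m) (Fin n)) =
      4 * (m : ℝ) * (n : ℝ) * ((m : ℝ) + (n : ℝ) - 2) / ((m : ℝ) + (n : ℝ)) := by
  have hm' : (1:ℝ) ≤ m := by exact_mod_cast hm
  have hn' : (1:ℝ) ≤ n := by exact_mod_cast hn
  have hT : (cnrs (completeBipartiteGraph (Fin m) (Fin n))).trace
      = (m:ℝ) * n * (m + n - 2) := by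
    rw [cnrs_kmn]; simp [Matrix.trace, Fintype.sum_sum_type]; ring
  have hS : ∑ i, (cnl_isHermitian (completeBipartiteGraph (Fin m) (Fin n))).eigenvalues i
      = (m:ℝ) * n * (m + n - 2) := by
    have h1 := (cnl_isHermitian (completeBipartiteGraph (Fin m) (Fin n))).trace_eq_sum_eigenvalues
    have h2 : (cn (completeBipartiteGraph (Fin m) (Fin n))).trace = 0 := by
      simp [Matrix.trace, cn]
    rw [show (cnl (completeBipartiteGraph (Fin m) (Fin n))).trace = (m:ℝ) * n * (m + n - 2) by
      rw [cnl, Matrix.trace_sub, h2, hT, sub_zero]] at h1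
    simpa using h1.symm
  have hc : (Fintype.card (Fin m ⊕ Fin n) : ℝ) = m + n := by simp
  have hp : (0:ℝ) < m * n := by positivity
  have hs : (0:ℝ) < m + n := by positivity
  unfold LEcn
  rw [hT, hc]
  set a : ℝ := (m:ℝ) * n * (m + n - 2) / (m + n) with ha
  have ha0 : 0 ≤ a := div_nonneg (mul_nonneg hp.le (by linarith)) hs.le
  have ha1 : a ≤ m * n := by
    rw [ha, div_le_iff₀ hs]; nlinarith
  have : ∀ i, |(cnl_isHermitian (completeBipartiteGraph (Fin m) (Fin n))).eigenvalues i - a|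
      = a + (cnl_isHermitian (completeBipartiteGraph (Fin m) (Fin n))).eigenvalues i
        * ((m * n - 2 * a) / (m * n)) := by
    intro i
    rcases eig_quad (cnl_isHermitian (completeBipartiteGraph (Fin m) (Fin n))) _ (cnl_sq m n) i
      with h | h <;> rw [h]
    · rw [zero_sub, abs_neg, abs_of_nonneg ha0]; ring
    · rw [abs_of_nonneg (by linarith), mul_div_cancel₀ _ hp.ne']; ring
  rw [Finset.sum_congr rfl (fun i _ => this i), Finset.sum_add_distrib, ← Finset.sum_mul, hS]
  rw [Finset.sum_const, Finset.card_univ, nsmul_eq_mul, hc, ha]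
  have : (m:ℝ) ≠ 0 := by positivity
  have : (n:ℝ) ≠ 0 := by positivity
  field_simp
  ring

end CNE
end

section
/- For the star graph S_k = K_{1,k} with one internal node and k ≥ 1 leaves, LE_CN(S_k) = 4k(k-1)/(k+1). -/
set_option linter.unusedSectionVars false

open Matrix BigOperators Finset

namespace CNE

variable {V : Type*} [Fintype V]

lemma cn_star (k : ℕ) : cn (completeBipartiteGraph (Fin 1) (Fin k)) =
    Matrix.of fun i j => match i, j with
      | Sum.inr a, Sum.inr b => if a = b then 0 else 1
      | _, _ => 0 := by
  ext i j
  rcases i with a | a <;> rcases j with b | b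
  · have : a = b := Subsingleton.elim _ _
    simp [cn, this]
  · have : (completeBipartiteGraph (Fin 1) (Fin k)).commonNeighbors (Sum.inl a) (Sum.inr b) = ∅ := by
      ext x
      rcases x with x | x <;> simp [SimpleGraph.mem_commonNeighbors]
    simp [cn, this]
  · have : (completeBipartiteGraph (Fin 1) (Fin k)).commonNeighbors (Sum.inr a) (Sum.inl b) = ∅ := by
      ext x
      rcases x with x | x <;> simp [SimpleGraph.mem_commonNeighbors]
    simp [cn, this]
  · have : (completeBipartiteGraph (Fin 1) (Fin k)).commonNeighbors (Sum.inr a) (Sum.inr b) =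
        {Sum.inl 0} := by
      ext x
      rcases x with x | x
      · simp [SimpleGraph.mem_commonNeighbors, Subsingleton.elim x 0]
      · simp [SimpleGraph.mem_commonNeighbors]
    simp [cn, this]

lemma row_star (k : ℕ) (a : Fin k) : ∑ b : Fin k, (if a = b then (0:ℝ) else 1) = k - 1 := by
  have : ∀ b : Fin k, (if a = b then (0:ℝ) else 1) = 1 - (if a = b then 1 else 0) := by
    intro b; split_ifs <;> simp
  simp [this, Finset.sum_sub_distrib]

lemma trace_cnrs_star (k : ℕ) :
    (cnrs (completeBipartiteGraph (Fin 1) (Fin k))).trace = k * (k - 1) := by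
  simp [cnrs, cn_star, Matrix.trace, row_star]
  ring

lemma trace_cnl_star (k : ℕ) :
    (cnl (completeBipartiteGraph (Fin 1) (Fin k))).trace = k * (k - 1) := by
  rw [cnl, Matrix.trace_sub, trace_cnrs_star]
  simp [cn, Matrix.trace]

lemma cnl_star (k : ℕ) : cnl (completeBipartiteGraph (Fin 1) (Fin k)) =
    Matrix.fromBlocks 0 0 0 ((k : ℝ) • (1 : Matrix (Fin k) (Fin k) ℝ) - Matrix.of fun _ _ => 1) := by
  ext i j
  rcases i with a | a <;> rcases j with b | b
  · have : a = b := Subsingleton.elim _ _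
    simp [cnl, cnrs, cn_star, this]
  · simp [cnl, cnrs, cn_star]
  · simp [cnl, cnrs, cn_star]
  · by_cases h : a = b
    · subst h
      simp [cnl, cnrs, cn_star, row_star]
    · simp [cnl, cnrs, cn_star, h, Matrix.diagonal_apply]

lemma cnl_star_sq (k : ℕ) : cnl (completeBipartiteGraph (Fin 1) (Fin k)) *
    cnl (completeBipartiteGraph (Fin 1) (Fin k)) =
    (k : ℝ) • cnl (completeBipartiteGraph (Fin 1) (Fin k)) := by
  have hJ : (Matrix.of fun (_ _ : Fin k) => (1:ℝ)) * (Matrix.of fun _ _ => (1:ℝ)) =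
      (k : ℝ) • Matrix.of fun _ _ => 1 := by
    ext i j; simp [Matrix.mul_apply]
  rw [cnl_star, Matrix.fromBlocks_multiply, Matrix.fromBlocks_smul]
  congr 1 <;> simp [sub_mul, mul_sub, hJ, smul_sub]

lemma eig_star (k : ℕ) (i) :
    (cnl_isHermitian (completeBipartiteGraph (Fin 1) (Fin k))).eigenvalues i = 0 ∨
    (cnl_isHermitian (completeBipartiteGraph (Fin 1) (Fin k))).eigenvalues i = k := by
  set hM := cnl_isHermitian (completeBipartiteGraph (Fin 1) (Fin k))
  have h1 := hM.mulVec_eigenvectorBasis i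
  have h2 := congrArg (fun A => A *ᵥ (hM.eigenvectorBasis i).ofLp) (cnl_star_sq k)
  simp only [← Matrix.mulVec_mulVec, Matrix.smul_mulVec, h1, Matrix.mulVec_smul] at h2
  have hne : (hM.eigenvectorBasis i).ofLp ≠ 0 := by
    intro h
    exact hM.eigenvectorBasis.toBasis.ne_zero i (by simpa using h)
  rw [smul_smul, smul_smul] at h2
  have h3 := smul_left_injective ℝ hne h2
  by_cases h0 : hM.eigenvalues i = 0
  · exact Or.inl h0
  · exact Or.inr (mul_right_cancel₀ h0 h3)

theorem statement8 (k : ℕ) (hk : 1 ≤ k) :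
    LEcn (completeBipartiteGraph (Fin 1) (Fin k)) =
      4 * (k : ℝ) * ((k : ℝ) - 1) / ((k : ℝ) + 1) := by
  have hk' : (1:ℝ) ≤ k := by exact_mod_cast hk
  unfold LEcn
  rw [trace_cnrs_star]
  have hc : ((Fintype.card (Fin 1 ⊕ Fin k) : ℕ) : ℝ) = k + 1 := by
    simp [add_comm]
  rw [hc]
  have htr := (cnl_isHermitian (completeBipartiteGraph (Fin 1) (Fin k))).trace_eq_sum_eigenvalues
  rw [trace_cnl_star] at htr
  simp only [RCLike.ofReal_real_eq_id, id_eq] at htr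
  set a : ℝ := k * (k - 1) / (k + 1) with ha
  have ha0 : 0 ≤ a := div_nonneg (mul_nonneg (by linarith) (by linarith)) (by linarith)
  have hak : a ≤ k := by
    rw [ha, div_le_iff₀ (by linarith)]; nlinarith
  have key : ∀ i, |(cnl_isHermitian (completeBipartiteGraph (Fin 1) (Fin k))).eigenvalues i - a|
      = a + (cnl_isHermitian (completeBipartiteGraph (Fin 1) (Fin k))).eigenvalues i
        * ((k - 2 * a) / k) := by
    intro i
    rcases eig_star k i with h | h <;> rw [h]
    · rw [zero_sub, abs_neg, abs_of_nonneg ha0]; ring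
    · rw [abs_of_nonneg (by linarith)]; field_simp; ring
  rw [Finset.sum_congr rfl fun i _ => key i, Finset.sum_add_distrib, ← Finset.sum_mul, ← htr,
    Finset.sum_const, Finset.card_univ, nsmul_eq_mul, hc, ha]
  field_simp
  ring

end CNE
end

section
/- For the star graph S_k = K_{1,k} with one internal node and k ≥ 2 leaves, LE⁺_CN(S_k) = 2(k-1)(k+2)/(k+1). -/
set_option linter.unusedSectionVars false

open Matrix BigOperators Finset

namespace CNE

variable {V : Type*} [Fintype V]

open Polynomial in
lemma charpoly_aux (m : ℕ) (b : ℝ) :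
    (vecMulVec (fun _ : Fin (m+1) => (1:ℝ)) (fun _ => 1) - scalar (Fin (m+1)) (-b)).charpoly
      = (X - C b) ^ m * (X - C (b + (m + 1))) := by
  rw [charpoly_sub_scalar, charpoly_vecMulVec]
  simp [dotProduct, Polynomial.smul_eq_C_mul]
  ring

lemma cn_inl (k : ℕ) (a : Fin 1) (j) :
    cn (completeBipartiteGraph (Fin 1) (Fin k)) (Sum.inl a) j = 0 := by
  rcases j with j | j
  · simp [cn, Subsingleton.elim a j]
  · have : (completeBipartiteGraph (Fin 1) (Fin k)).commonNeighbors (Sum.inl a) (Sum.inr j) = ∅ := by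
      ext x
      rcases x with x | x <;> simp [SimpleGraph.mem_commonNeighbors]
    simp [cn, this]

lemma cn_inr_inl (k : ℕ) (a : Fin 1) (j) :
    cn (completeBipartiteGraph (Fin 1) (Fin k)) (Sum.inr j) (Sum.inl a) = 0 := by
  have h := (cn_isHermitian (completeBipartiteGraph (Fin 1) (Fin k))).apply (Sum.inr j) (Sum.inl a)
  rw [cn_inl] at h
  simpa using h.symm

lemma cn_inr_inr (k : ℕ) (i j : Fin k) :
    cn (completeBipartiteGraph (Fin 1) (Fin k)) (Sum.inr i) (Sum.inr j)
      = if i = j then 0 else 1 := by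
  have : (completeBipartiteGraph (Fin 1) (Fin k)).commonNeighbors (Sum.inr i) (Sum.inr j)
      = {Sum.inl 0} := by
    ext x
    rcases x with x | x
    · simp [SimpleGraph.mem_commonNeighbors, Subsingleton.elim x 0]
    · simp [SimpleGraph.mem_commonNeighbors]
  simp [cn, this]

lemma row_inr (k : ℕ) (i : Fin k) :
    ∑ j, cn (completeBipartiteGraph (Fin 1) (Fin k)) (Sum.inr i) j = (k : ℝ) - 1 := by
  have h : ∀ j : Fin k, (if i = j then (0:ℝ) else 1) = 1 - if i = j then 1 else 0 := by
    intro j; split_ifs <;> norm_num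
  simp [Fintype.sum_sum_type, cn_inr_inl, cn_inr_inr, h, -Finset.sum_boole]

lemma cnsl_eq (k : ℕ) :
    cnsl (completeBipartiteGraph (Fin 1) (Fin k)) =
      fromBlocks 0 0 0 (vecMulVec (fun _ : Fin k => (1:ℝ)) (fun _ => 1)
        - scalar (Fin k) (-((k:ℝ) - 2))) := by
  ext i j
  rcases i with i | i <;> rcases j with j | j
  · simp [cnsl, cnrs, cn_inl, diagonal_apply]
  · simp [cnsl, cnrs, cn_inl]
  · simp [cnsl, cnrs, cn_inr_inl]
  · by_cases h : i = j
    · subst h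
      simp [cnsl, cnrs, cn_inr_inr, row_inr, vecMulVec_apply, -Fintype.sum_sum_type]
      ring
    · simp [cnsl, cnrs, cn_inr_inr, h, vecMulVec_apply]

lemma trace_eq (k : ℕ) :
    (cnrs (completeBipartiteGraph (Fin 1) (Fin k))).trace = k * ((k:ℝ) - 1) := by
  rw [cnrs, trace_diagonal, Fintype.sum_sum_type]
  simp [cn_inl, row_inr, -Fintype.sum_sum_type]
  ring

open Polynomial in
lemma roots_aux (m : ℕ) (b c : ℝ) :
    ((X : ℝ[X]) * ((X - C b) ^ m * (X - C c))).roots = {0} + (m • {b} + {c}) := by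
  have h1 : (X - C b) ^ m ≠ 0 := pow_ne_zero _ (X_sub_C_ne_zero b)
  have h2 := X_sub_C_ne_zero c
  rw [roots_mul (mul_ne_zero X_ne_zero (mul_ne_zero h1 h2)), roots_mul (mul_ne_zero h1 h2)]
  simp

theorem statement9 (k : ℕ) (hk : 2 ≤ k) :
    LEpcn (completeBipartiteGraph (Fin 1) (Fin k)) =
      2 * ((k : ℝ) - 1) * ((k : ℝ) + 2) / ((k : ℝ) + 1) := by
  obtain ⟨m, rfl⟩ : ∃ m, k = m + 1 := ⟨k - 1, by omega⟩
  have hm : (1:ℝ) ≤ m := by exact_mod_cast (by omega : 1 ≤ m)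
  have hr := (cnsl_isHermitian (completeBipartiteGraph (Fin 1) (Fin (m+1)))).roots_charpoly_eq_eigenvalues
  have hc : (cnsl (completeBipartiteGraph (Fin 1) (Fin (m+1)))).charpoly.roots
      = {0} + (m • {(m:ℝ) - 1} + {2 * (m:ℝ)}) := by
    rw [cnsl_eq, charpoly_fromBlocks_zero₁₂, charpoly_aux, charpoly_zero, Fintype.card_fin, pow_one,
      roots_aux]
    push_cast
    ring_nf
  rw [hc] at hr
  unfold LEpcn
  rw [trace_eq]
  set t : ℝ := ((m + 1 : ℕ) : ℝ) * (((m + 1 : ℕ) : ℝ) - 1) /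
    (Fintype.card (Fin 1 ⊕ Fin (m + 1)) : ℝ) with ht
  have h := congrArg (fun s : Multiset ℝ => (s.map (fun x => |x - t|)).sum) hr
  simp only [Multiset.map_map, Multiset.map_add, Multiset.sum_add, Multiset.map_nsmul,
    Multiset.sum_nsmul, Multiset.map_singleton, Multiset.sum_singleton] at h
  have h' : ∑ i, |(cnsl_isHermitian (completeBipartiteGraph (Fin 1) (Fin (m+1)))).eigenvalues i - t|
    = |0 - t| + (m • |(m:ℝ) - 1 - t| + |2 * (m:ℝ) - t|) := h.symm
  rw [h']
  have ht2 : t = (m + 1) * m / (m + 2) := by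
    rw [ht]; simp; ring
  have hpos : (0:ℝ) < m + 2 := by linarith
  have e1 : 0 ≤ t := by rw [ht2]; positivity
  have e2 : (m:ℝ) - 1 ≤ t := by rw [ht2, le_div_iff₀ hpos]; nlinarith
  have e3 : t ≤ 2 * m := by rw [ht2, div_le_iff₀ hpos]; nlinarith
  rw [abs_of_nonpos (by linarith), abs_of_nonpos (by linarith), abs_of_nonneg (by linarith), ht2]
  push_cast
  rw [nsmul_eq_mul]
  field_simp
  ring

end CNE
end

section
/- For any finite simple graph G on n vertices with |e(G)| edges, the common neighborhood energy satisfies E_CN(G) ≤ 2|e(G)|(n + 1). -/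
set_option linter.unusedSectionVars false

open Matrix BigOperators Finset

namespace CNE

variable {V : Type*} [Fintype V]

lemma energy_le_aux [DecidableEq V] {M P Q : Matrix V V ℝ} (hM : M.IsHermitian)
    (hP : P.PosSemidef) (hQ : Q.PosSemidef) (h : M = P - Q) :
    ∑ i, |hM.eigenvalues i| ≤ P.trace + Q.trace := by
  set U : Matrix V V ℝ := (hM.eigenvectorUnitary : Matrix V V ℝ) with hU
  have hUU : U * Uᴴ = 1 := Unitary.mul_star_self_of_mem hM.eigenvectorUnitary.2
  have hUU' : Uᴴ * U = 1 := Unitary.star_mul_self_of_mem hM.eigenvectorUnitary.2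
  have hsp : Uᴴ * M * U = Matrix.diagonal hM.eigenvalues := by
    have := hM.spectral_theorem
    rw [Unitary.conjStarAlgAut_apply] at this
    have h2 : M = U * Matrix.diagonal hM.eigenvalues * Uᴴ := this
    calc Uᴴ * M * U = Uᴴ * (U * Matrix.diagonal hM.eigenvalues * Uᴴ) * U := by rw [← h2]
      _ = (Uᴴ * U) * Matrix.diagonal hM.eigenvalues * (Uᴴ * U) := by
        simp only [Matrix.mul_assoc]
      _ = _ := by rw [hUU']; simp
  have hP' := hP.conjTranspose_mul_mul_same U
  have hQ' := hQ.conjTranspose_mul_mul_same U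
  have tr : ∀ X : Matrix V V ℝ, (Uᴴ * X * U).trace = X.trace := by
    intro X
    rw [Matrix.trace_mul_comm, ← Matrix.mul_assoc, hUU, Matrix.one_mul]
  rw [← tr P, ← tr Q, Matrix.trace, Matrix.trace, ← Finset.sum_add_distrib]
  apply Finset.sum_le_sum
  intro i _
  have e : hM.eigenvalues i = (Uᴴ * P * U) i i - (Uᴴ * Q * U) i i := by
    rw [← Matrix.sub_apply, ← Matrix.sub_mul, ← Matrix.mul_sub, ← h, hsp]
    simp
  have h1 : 0 ≤ (Uᴴ * P * U) i i := hP'.diag_nonneg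
  have h2 : 0 ≤ (Uᴴ * Q * U) i i := hQ'.diag_nonneg
  rw [e]
  simp only [Matrix.diag_apply]
  rw [abs_le]
  constructor <;> linarith

lemma cn_eq_aux [DecidableEq V] (G : SimpleGraph V) [DecidableRel G.Adj] :
    cn G = G.adjMatrix ℝ * G.adjMatrix ℝ - Matrix.diagonal fun i => (G.degree i : ℝ) := by
  ext i j
  by_cases h : i = j
  · subst h
    rw [Matrix.sub_apply, SimpleGraph.adjMatrix_mul_self_apply_self]
    simp [cn]
  · simp only [cn, Matrix.of_apply, if_neg h, Matrix.sub_apply, Matrix.diagonal_apply_ne _ h,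
      sub_zero, Matrix.mul_apply, SimpleGraph.adjMatrix_apply]
    rw [Nat.card_eq_fintype_card, ← Set.toFinset_card]
    simp only [← ite_and, mul_ite, mul_one, mul_zero]
    rw [Finset.sum_boole]
    congr 2
    ext k
    simp [SimpleGraph.mem_commonNeighbors, G.adj_comm k j, and_comm]

theorem statement12 [DecidableEq V] (G : SimpleGraph V) [DecidableRel G.Adj] :
    Ecn G ≤ 2 * (G.edgeFinset.card : ℝ) * ((Fintype.card V : ℝ) + 1) := by
  have key := energy_le_aux (cn_isHermitian G)
    (P := G.adjMatrix ℝ * G.adjMatrix ℝ) (Q := Matrix.diagonal fun i => (G.degree i : ℝ))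
    (by
      have := Matrix.posSemidef_conjTranspose_mul_self (G.adjMatrix ℝ)
      rwa [Matrix.conjTranspose_eq_transpose_of_trivial, SimpleGraph.transpose_adjMatrix] at this)
    (Matrix.PosSemidef.diagonal fun i => by simp) (cn_eq_aux G)
  have hs : ∑ i, (G.degree i : ℝ) = 2 * (G.edgeFinset.card : ℝ) := by
    exact_mod_cast G.sum_degrees_eq_twice_card_edges
  have t1 : (G.adjMatrix ℝ * G.adjMatrix ℝ).trace = 2 * (G.edgeFinset.card : ℝ) := by
    rw [← hs, Matrix.trace]
    exact Finset.sum_congr rfl fun i _ => SimpleGraph.adjMatrix_mul_self_apply_self G i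
  rw [t1, Matrix.trace_diagonal, hs] at key
  rcases isEmpty_or_nonempty V with hV | hV
  · simp [Ecn]
  · have hn : (1 : ℝ) ≤ Fintype.card V := by exact_mod_cast Fintype.card_pos
    have hm : (0 : ℝ) ≤ G.edgeFinset.card := by positivity
    change Ecn G ≤ _ at key
    nlinarith

end CNE
end

section
/- For any finite simple graph G with |e(G)| edges and first Zagreb index M1(G), LE_CN(G) ≤ E_CN(G) + 2(M1(G) - 2|e(G)|) and LE⁺_CN(G) ≤ E_CN(G) + 2(M1(G) - 2|e(G)|). -/
set_option linter.unusedSectionVars false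

open Matrix BigOperators Finset

namespace CNE

variable {V : Type*} [Fintype V]

lemma aux_sq [DecidableEq V] (Q : Matrix V V ℝ) (hQ : Qᵀ * Q = 1) (μ : V → ℝ) :
    ∑ i, |∑ j, μ j * Q i j ^ 2| ≤ ∑ j, |μ j| := by
  calc ∑ i, |∑ j, μ j * Q i j ^ 2| ≤ ∑ i, ∑ j, |μ j| * Q i j ^ 2 := by
        refine Finset.sum_le_sum fun i _ => (Finset.abs_sum_le_sum_abs _ _).trans (le_of_eq ?_)
        refine Finset.sum_congr rfl fun j _ => ?_
        rw [abs_mul, abs_of_nonneg (sq_nonneg (Q i j))]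
    _ = ∑ j, |μ j| := by
        rw [Finset.sum_comm]
        refine Finset.sum_congr rfl fun j _ => ?_
        have h := congrFun (congrFun hQ j) j
        simp only [Matrix.mul_apply, Matrix.transpose_apply, Matrix.one_apply_eq] at h
        rw [← Finset.mul_sum]
        simp only [sq, h, mul_one]

lemma aux_conj [DecidableEq V] (W U : Matrix V V ℝ) (hW : W * Wᵀ = 1) (hU : Uᵀ * U = 1)
    (μ : V → ℝ) :
    ∑ i, |(Wᵀ * (U * diagonal μ * Uᵀ) * W) i i| ≤ ∑ j, |μ j| := by
  have hQ : (Wᵀ * U)ᵀ * (Wᵀ * U) = 1 := by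
    rw [transpose_mul, transpose_transpose, Matrix.mul_assoc, ← Matrix.mul_assoc W, hW,
      Matrix.one_mul, hU]
  refine le_trans (le_of_eq ?_) (aux_sq _ hQ μ)
  refine Finset.sum_congr rfl fun i _ => ?_
  have : Wᵀ * (U * diagonal μ * Uᵀ) * W = (Wᵀ * U) * diagonal μ * (Wᵀ * U)ᵀ := by
    simp only [transpose_mul, transpose_transpose, Matrix.mul_assoc]
  rw [this, Matrix.mul_apply]
  congr 1
  refine Finset.sum_congr rfl fun j _ => ?_
  rw [Matrix.mul_diagonal, Matrix.transpose_apply]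
  ring

lemma aux_spec [DecidableEq V] (A : Matrix V V ℝ) (hA : A.IsHermitian) :
    ∃ U : Matrix V V ℝ, U * Uᵀ = 1 ∧ Uᵀ * U = 1 ∧ A = U * diagonal hA.eigenvalues * Uᵀ := by
  have hs : (star (hA.eigenvectorUnitary : Matrix V V ℝ)) =
      (hA.eigenvectorUnitary : Matrix V V ℝ)ᵀ := by
    ext i j; simp [Matrix.star_apply]
  refine ⟨hA.eigenvectorUnitary, ?_, ?_, ?_⟩
  · rw [← hs]; exact Unitary.coe_mul_star_self _
  · rw [← hs]; exact Unitary.coe_star_mul_self _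
  · have h := hA.spectral_theorem
    rw [Unitary.conjStarAlgAut_apply, hs] at h
    exact h

lemma aux_main [DecidableEq V] (M C : Matrix V V ℝ) (d : V → ℝ) (c s : ℝ) (hs : |s| = 1)
    (hM : M.IsHermitian) (hC : C.IsHermitian) (h : M = diagonal d + s • C) :
    ∑ i, |hM.eigenvalues i - c| ≤ ∑ i, |hC.eigenvalues i| + ∑ i, |d i - c| := by
  obtain ⟨W, hW1, hW2, hW3⟩ := aux_spec M hM
  obtain ⟨U, hU1, hU2, hU3⟩ := aux_spec C hC
  have h1 := aux_conj W U hW1 hU2 hC.eigenvalues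
  rw [← hU3] at h1
  have h2 := aux_conj W 1 hW1 (by simp) (fun i => d i - c)
  simp only [Matrix.one_mul, transpose_one, Matrix.mul_one] at h2
  refine le_trans ?_ (add_le_add h1 h2)
  rw [← Finset.sum_add_distrib]
  refine Finset.sum_le_sum fun i _ => ?_
  have hd : Wᵀ * M * W = diagonal hM.eigenvalues := by
    conv_lhs => rw [hW3]
    calc Wᵀ * (W * diagonal hM.eigenvalues * Wᵀ) * W
        = (Wᵀ * W) * diagonal hM.eigenvalues * (Wᵀ * W) := by simp only [Matrix.mul_assoc]
      _ = _ := by rw [hW2]; simp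
  have hdc : (diagonal fun i => d i - c) = M - s • C - c • (1 : Matrix V V ℝ) := by
    rw [h, add_sub_cancel_right]
    ext a b
    by_cases hab : a = b
    · subst hab; simp
    · simp [hab]
  have key : hM.eigenvalues i - c =
      s * (Wᵀ * C * W) i i + (Wᵀ * (diagonal fun i => d i - c) * W) i i := by
    rw [hdc]
    simp only [Matrix.mul_sub, Matrix.sub_mul, hd, Matrix.mul_smul, Matrix.smul_mul,
      Matrix.mul_one, hW2, Matrix.sub_apply, Matrix.smul_apply, smul_eq_mul,
      Matrix.diagonal_apply_eq, Matrix.one_apply_eq]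
    ring
  rw [key]
  refine (abs_add_le _ _).trans ?_
  rw [abs_mul, hs, one_mul]

lemma aux_cn [DecidableEq V] (G : SimpleGraph V) [DecidableRel G.Adj] (i j : V) :
    cn G i j = ∑ u, G.adjMatrix ℝ u i * G.adjMatrix ℝ u j -
      (if i = j then (G.degree i : ℝ) else 0) := by
  have h : (∑ u, G.adjMatrix ℝ u i * G.adjMatrix ℝ u j) =
      (Nat.card (G.commonNeighbors i j) : ℝ) := by
    rw [Nat.card_eq_fintype_card, Fintype.card_subtype, Finset.card_filter]
    push_cast
    refine Finset.sum_congr rfl fun u _ => ?_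
    simp only [SimpleGraph.adjMatrix_apply, SimpleGraph.mem_commonNeighbors, G.adj_comm u]
    by_cases h1 : G.Adj i u <;> by_cases h2 : G.Adj j u <;> simp [h1, h2]
  rw [h]
  simp only [cn, Matrix.of_apply]
  split_ifs with hij
  · subst hij
    rw [SimpleGraph.commonNeighbors_eq, Set.inter_self, Nat.card_eq_fintype_card,
      SimpleGraph.card_neighborSet_eq_degree, sub_self]
  · simp

lemma aux_trace [DecidableEq V] (G : SimpleGraph V) [DecidableRel G.Adj] :
    ∑ i, ∑ j, cn G i j =
      (∑ v, (G.degree v : ℝ) ^ 2) - 2 * (G.edgeFinset.card : ℝ) := by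
  have hdeg : ∑ v, (G.degree v : ℝ) = 2 * (G.edgeFinset.card : ℝ) := by
    exact_mod_cast G.sum_degrees_eq_twice_card_edges
  have hrow : ∀ u, ∑ i, G.adjMatrix ℝ u i = (G.degree u : ℝ) := by
    intro u
    simp [SimpleGraph.adjMatrix_apply, ← SimpleGraph.card_neighborFinset_eq_degree, SimpleGraph.neighborFinset_eq_filter]
  simp only [aux_cn, Finset.sum_sub_distrib, Finset.sum_ite_eq, Finset.mem_univ, if_true, hdeg]
  congr 1
  calc ∑ i, ∑ j, ∑ u, G.adjMatrix ℝ u i * G.adjMatrix ℝ u j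
      = ∑ i, ∑ u, ∑ j, G.adjMatrix ℝ u i * G.adjMatrix ℝ u j :=
        Finset.sum_congr rfl fun i _ => Finset.sum_comm
    _ = ∑ u, ∑ i, ∑ j, G.adjMatrix ℝ u i * G.adjMatrix ℝ u j := Finset.sum_comm
    _ = _ := by
        refine Finset.sum_congr rfl fun u _ => ?_
        simp only [← Finset.mul_sum, hrow, ← Finset.sum_mul]
        ring

lemma aux_dev [DecidableEq V] (G : SimpleGraph V) :
    ∑ i, |(∑ j, cn G i j) - (cnrs G).trace / (Fintype.card V : ℝ)| ≤
      2 * ∑ i, ∑ j, cn G i j := by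
  have h0 : ∀ i, 0 ≤ ∑ j, cn G i j := by
    intro i
    refine Finset.sum_nonneg fun j _ => ?_
    simp only [cn, Matrix.of_apply]
    split_ifs <;> positivity
  have ht : (cnrs G).trace = ∑ i, ∑ j, cn G i j := by
    simp [cnrs, Matrix.trace_diagonal]
  have ht0 : 0 ≤ ∑ i, ∑ j, cn G i j := Finset.sum_nonneg fun i _ => h0 i
  rw [ht]
  set T := ∑ i, ∑ j, cn G i j with hT
  have hc : 0 ≤ T / (Fintype.card V : ℝ) := by positivity
  calc _ ≤ ∑ i, ((∑ j, cn G i j) + T / (Fintype.card V : ℝ)) := by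
        refine Finset.sum_le_sum fun i _ => ?_
        have := h0 i
        rw [abs_le]
        constructor <;> linarith
    _ = T + (Fintype.card V : ℝ) * (T / (Fintype.card V : ℝ)) := by
        rw [Finset.sum_add_distrib, ← hT]
        simp
    _ ≤ 2 * T := by
        rcases eq_or_ne (Fintype.card V : ℝ) 0 with h | h
        · rw [h]; linarith
        · rw [mul_div_cancel₀ _ h]; linarith

theorem statement13 [DecidableEq V] (G : SimpleGraph V) [DecidableRel G.Adj] :
    LEcn G ≤ Ecn G +
        2 * ((∑ v, (G.degree v : ℝ) ^ 2) - 2 * (G.edgeFinset.card : ℝ)) ∧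
    LEpcn G ≤ Ecn G +
        2 * ((∑ v, (G.degree v : ℝ) ^ 2) - 2 * (G.edgeFinset.card : ℝ)) := by
  rw [← aux_trace]
  constructor
  · refine le_trans (aux_main (cnl G) (cn G) (fun i => ∑ j, cn G i j) _ (-1) (by simp)
      (cnl_isHermitian G) (cn_isHermitian G) ?_) (add_le_add le_rfl (aux_dev G))
    simp [cnl, cnrs, sub_eq_add_neg]
  · refine le_trans (aux_main (cnsl G) (cn G) (fun i => ∑ j, cn G i j) _ 1 (by simp)
      (cnsl_isHermitian G) (cn_isHermitian G) ?_) (add_le_add le_rfl (aux_dev G))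
    simp [cnsl, cnrs]

end CNE
end

section
/- For any finite simple graph G with |e(G)| edges and first Zagreb index M1(G), both LE_CN(G) and LE⁺_CN(G) are bounded above by E(G)² + 2(M1(G) - |e(G)|), where E(G) is the energy of G. -/
set_option linter.unusedSectionVars false

open Matrix BigOperators Finset

namespace CNE

variable {V : Type*} [Fintype V]

lemma cn_nonneg' [DecidableEq V] (G : SimpleGraph V) (i j : V) : 0 ≤ cn G i j := by
  simp only [cn, Matrix.of_apply]
  split_ifs <;> positivity

lemma cn_symm' [DecidableEq V] (G : SimpleGraph V) (i j : V) : cn G i j = cn G j i := by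
  have := (cn_isHermitian G).apply i j
  simpa using this.symm

lemma trace_cn' [DecidableEq V] (G : SimpleGraph V) : (cn G).trace = 0 := by
  simp [Matrix.trace, cn]

lemma quad' [DecidableEq V] (G : SimpleGraph V) (s : ℝ) (hs : s ^ 2 = 1) (x : V → ℝ) :
    0 ≤ ∑ i, ∑ j, cn G i j * (x i ^ 2 + s * (x i * x j)) := by
  have h1 : ∑ i, ∑ j, cn G i j * (x i ^ 2 + s * (x i * x j))
      = ∑ i, ∑ j, cn G i j * (x j ^ 2 + s * (x i * x j)) := by
    rw [Finset.sum_comm]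
    refine Finset.sum_congr rfl fun i _ => Finset.sum_congr rfl fun j _ => ?_
    rw [cn_symm' G j i]; ring
  have h2 : 0 ≤ ∑ i, ∑ j, cn G i j * (x i + s * x j) ^ 2 :=
    Finset.sum_nonneg fun i _ => Finset.sum_nonneg fun j _ =>
      mul_nonneg (cn_nonneg' G i j) (sq_nonneg _)
  have h3 : ∑ i, ∑ j, cn G i j * (x i + s * x j) ^ 2
      = ∑ i, ∑ j, cn G i j * (x i ^ 2 + s * (x i * x j))
        + ∑ i, ∑ j, cn G i j * (x j ^ 2 + s * (x i * x j)) := by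
    simp only [← Finset.sum_add_distrib]
    refine Finset.sum_congr rfl fun i _ => Finset.sum_congr rfl fun j _ => ?_
    linear_combination (cn G i j * x j ^ 2) * hs
  linarith

lemma psd' [DecidableEq V] (G : SimpleGraph V) (s : ℝ) (hs : s ^ 2 = 1) :
    (cnrs G + s • cn G).PosSemidef := by
  refine Matrix.PosSemidef.of_dotProduct_mulVec_nonneg ?_ fun x => ?_
  · refine (cnrs_isHermitian G).add ?_
    ext i j
    simp [cn_symm' G j i]
  · have := quad' G s hs x
    refine this.trans_eq (Eq.symm ?_)
    simp only [dotProduct, Matrix.add_mulVec, Matrix.smul_mulVec, Pi.add_apply, cnrs,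
      Matrix.mulVec_diagonal, Pi.smul_apply, smul_eq_mul, Pi.star_apply, star_trivial]
    refine Finset.sum_congr rfl fun i _ => ?_
    simp only [Matrix.mulVec, dotProduct, Finset.sum_mul, Finset.mul_sum, mul_add,
      ← Finset.sum_add_distrib]
    refine Finset.sum_congr rfl fun j _ => ?_
    ring

lemma bound' [DecidableEq V] (G : SimpleGraph V) {M : Matrix V V ℝ} (hM : M.IsHermitian)
    (hp : M.PosSemidef) (ht : M.trace = (cnrs G).trace) :
    ∑ i, |hM.eigenvalues i - (cnrs G).trace / (Fintype.card V : ℝ)| ≤ 2 * (cnrs G).trace := by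
  have h0 : 0 ≤ (cnrs G).trace := ht ▸ hp.trace_nonneg
  have hsum : ∑ i, hM.eigenvalues i = (cnrs G).trace := by
    rw [← ht, hM.trace_eq_sum_eigenvalues]; simp
  have hc : ∑ _i : V, (cnrs G).trace / (Fintype.card V : ℝ) ≤ (cnrs G).trace := by
    rw [Finset.sum_const, Finset.card_univ, nsmul_eq_mul]
    rcases eq_or_ne (Fintype.card V : ℝ) 0 with h | h
    · rw [h, zero_mul]; exact h0
    · rw [mul_div_cancel₀ _ h]
  calc _ ≤ ∑ i, (hM.eigenvalues i + (cnrs G).trace / (Fintype.card V : ℝ)) := by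
        refine Finset.sum_le_sum fun i _ => ?_
        have h1 : 0 ≤ hM.eigenvalues i := hp.eigenvalues_nonneg i
        have h2 : 0 ≤ (cnrs G).trace / (Fintype.card V : ℝ) := by positivity
        rw [abs_le]; constructor <;> linarith
    _ ≤ _ := by rw [Finset.sum_add_distrib]; linarith

lemma trace_cnrs' [DecidableEq V] (G : SimpleGraph V) [DecidableRel G.Adj] :
    (cnrs G).trace = (∑ v, (G.degree v : ℝ) ^ 2) - 2 * (G.edgeFinset.card : ℝ) := by
  have hcn : ∀ i j, cn G i j = (∑ k, G.adjMatrix ℝ k i * G.adjMatrix ℝ k j)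
      - if i = j then (G.degree i : ℝ) else 0 := by
    intro i j
    have e : ∑ k, G.adjMatrix ℝ k i * G.adjMatrix ℝ k j
        = (Nat.card (G.commonNeighbors i j) : ℝ) := by
      rw [Nat.card_eq_fintype_card, ← Set.toFinset_card]
      simp only [SimpleGraph.adjMatrix_apply, ← ite_and, mul_ite, mul_one, mul_zero]
      rw [Finset.sum_boole]
      congr 2
      ext k
      simp [SimpleGraph.mem_commonNeighbors, G.adj_comm k, and_comm]
    rw [e]
    by_cases h : i = j
    · subst h
      have : Nat.card (G.commonNeighbors i i) = G.degree i := by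
        rw [SimpleGraph.commonNeighbors, Set.inter_self, Nat.card_eq_fintype_card,
          SimpleGraph.card_neighborSet_eq_degree]
      rw [this]; simp [cn]
    · simp [cn, h]
  have hd : ∀ k, ∑ i, G.adjMatrix ℝ k i = G.degree k := by
    intro k
    simp [SimpleGraph.adjMatrix_apply, ← SimpleGraph.card_neighborFinset_eq_degree,
      SimpleGraph.neighborFinset_eq_filter]
  have h2 : ∑ v, (G.degree v : ℝ) = 2 * (G.edgeFinset.card : ℝ) := by
    exact_mod_cast G.sum_degrees_eq_twice_card_edges
  have h3 : ∑ i, ∑ j, ∑ k, G.adjMatrix ℝ k i * G.adjMatrix ℝ k j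
      = ∑ v, (G.degree v : ℝ) ^ 2 := by
    have : ∀ i, ∑ j, ∑ k, G.adjMatrix ℝ k i * G.adjMatrix ℝ k j
        = ∑ k, ∑ j, G.adjMatrix ℝ k i * G.adjMatrix ℝ k j := fun i => Finset.sum_comm
    simp only [this]
    rw [Finset.sum_comm]
    refine Finset.sum_congr rfl fun k _ => ?_
    rw [← hd k, sq, Finset.sum_mul_sum]
  rw [cnrs, Matrix.trace_diagonal]
  simp only [hcn, Finset.sum_sub_distrib, h3, Finset.sum_ite_eq, Finset.mem_univ, if_true, h2]

theorem statement14 [DecidableEq V] (G : SimpleGraph V) [DecidableRel G.Adj] :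
    LEcn G ≤ (energy G) ^ 2 +
        2 * ((∑ v, (G.degree v : ℝ) ^ 2) - (G.edgeFinset.card : ℝ)) ∧
    LEpcn G ≤ (energy G) ^ 2 +
        2 * ((∑ v, (G.degree v : ℝ) ^ 2) - (G.edgeFinset.card : ℝ)) := by
  have hT := trace_cnrs' G
  have he : (0 : ℝ) ≤ (G.edgeFinset.card : ℝ) := Nat.cast_nonneg _
  have hE : 0 ≤ (energy G) ^ 2 := sq_nonneg _
  have hl : (cnl G).PosSemidef := by
    have := psd' G (-1) (by norm_num)
    simpa [cnl, sub_eq_add_neg] using this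
  have hsl : (cnsl G).PosSemidef := by
    have := psd' G 1 (by norm_num)
    simpa [cnsl] using this
  have h1 := bound' G (cnl_isHermitian G) hl (by rw [cnl, Matrix.trace_sub, trace_cn', sub_zero])
  have h2 := bound' G (cnsl_isHermitian G) hsl (by rw [cnsl, Matrix.trace_add, trace_cn', add_zero])
  unfold LEcn LEpcn
  constructor <;> linarith

end CNE
end

section
/- For any finite simple graph G with |e(G)| edges, the common neighborhood energy satisfies E_CN(G) ≤ 4|e(G)|. -/
set_option linter.unusedSectionVars false

open Matrix BigOperators Finset

namespace CNE

variable {V : Type*} [Fintype V]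

lemma cn_eq_sub [DecidableEq V] (G : SimpleGraph V) [DecidableRel G.Adj] :
    cn G = G.adjMatrix ℝ * G.adjMatrix ℝ - Matrix.diagonal fun v => (G.degree v : ℝ) := by
  ext i j
  rw [Matrix.sub_apply]
  by_cases h : i = j
  · subst h
    rw [SimpleGraph.adjMatrix_mul_self_apply_self]
    simp [cn]
  · rw [Matrix.diagonal_apply_ne _ h, sub_zero, SimpleGraph.adjMatrix_mul_apply]
    simp only [cn, Matrix.of_apply, if_neg h, SimpleGraph.adjMatrix_apply]
    rw [Finset.sum_boole]
    congr 1
    apply Nat.subtype_card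
    intro x
    simp [SimpleGraph.mem_commonNeighbors, G.adj_comm x j]

theorem statement15 [DecidableEq V] (G : SimpleGraph V) [DecidableRel G.Adj] :
    Ecn G ≤ 4 * (G.edgeFinset.card : ℝ) := by
  set A := G.adjMatrix ℝ with hA
  set D : Matrix V V ℝ := Matrix.diagonal fun v => (G.degree v : ℝ) with hD
  have hc : cn G = A * A - D := cn_eq_sub G
  set U : Matrix V V ℝ := ((cn_isHermitian G).eigenvectorUnitary : Matrix V V ℝ) with hU
  have hUU : U * Uᴴ = 1 := Unitary.mul_star_self_of_mem (cn_isHermitian G).eigenvectorUnitary.2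
  have hUU' : Uᴴ * U = 1 := Unitary.star_mul_self_of_mem (cn_isHermitian G).eigenvectorUnitary.2
  have hspec : Uᴴ * cn G * U = Matrix.diagonal (cn_isHermitian G).eigenvalues := by
    have h := (cn_isHermitian G).spectral_theorem
    rw [Unitary.conjStarAlgAut_apply] at h
    have h' : cn G = U * Matrix.diagonal (cn_isHermitian G).eigenvalues * Uᴴ := h
    have e : Uᴴ * (U * Matrix.diagonal (cn_isHermitian G).eigenvalues * Uᴴ) * U
      = (Uᴴ * U) * Matrix.diagonal (cn_isHermitian G).eigenvalues * (Uᴴ * U) := by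
      simp only [Matrix.mul_assoc]
    rw [← h', hUU', Matrix.one_mul, Matrix.mul_one] at e
    exact e
  have hAA : (A * A).PosSemidef := by
    have h := Matrix.posSemidef_conjTranspose_mul_self A
    have : Aᴴ = A := by
      rw [Matrix.conjTranspose_eq_transpose_of_trivial]; exact G.transpose_adjMatrix
    rwa [this] at h
  have hDD : D.PosSemidef := Matrix.PosSemidef.diagonal (fun v => by simp)
  have hP := hAA.conjTranspose_mul_mul_same U
  have hQ := hDD.conjTranspose_mul_mul_same U
  have htr : ∀ M : Matrix V V ℝ, (Uᴴ * M * U).trace = M.trace := by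
    intro M
    rw [Matrix.trace_mul_comm, ← Matrix.mul_assoc, hUU, Matrix.one_mul]
  have hdeg : ∑ v, (G.degree v : ℝ) = 2 * (G.edgeFinset.card : ℝ) := by
    exact_mod_cast G.sum_degrees_eq_twice_card_edges
  have tA : (A * A).trace = 2 * (G.edgeFinset.card : ℝ) := by
    rw [← hdeg]; exact Finset.sum_congr rfl fun v _ => G.adjMatrix_mul_self_apply_self v
  have tD : D.trace = 2 * (G.edgeFinset.card : ℝ) := by
    rw [← hdeg, hD, Matrix.trace_diagonal]
  have hle : Ecn G ≤ (Uᴴ * (A * A) * U).trace + (Uᴴ * D * U).trace := by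
    unfold Ecn Matrix.trace
    rw [← Finset.sum_add_distrib]
    refine Finset.sum_le_sum fun i _ => ?_
    have h1 : (cn_isHermitian G).eigenvalues i
        = (Uᴴ * (A * A) * U) i i - (Uᴴ * D * U) i i := by
      rw [← Matrix.sub_apply, ← Matrix.sub_mul, ← Matrix.mul_sub, ← hc, hspec,
        Matrix.diagonal_apply_eq]
    have h2 := hP.diag_nonneg (i := i)
    have h3 := hQ.diag_nonneg (i := i)
    rw [h1, abs_le]
    simp only [Matrix.diag_apply]
    constructor <;> linarith
  rw [htr, htr, tA, tD] at hle
  linarith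

end CNE
end
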